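/- Collision-reflection rigidity in the Newtonian case: let α = 1, let c_k be one of the centers, and let y : [t₀ − δ, t₀ + δ] → ℂ be continuous with y(t₀) = c_k, y(t) ∉ {c_1, …, c_N} for t ≠ t₀, twice differentiable and satisfying the N-center equation on [t₀ − δ, t₀ + δ] \ {t₀}, with constant energy ½|ẏ(t)|² − V(y(t)) = h there. If the one-sided direction limits lim_{t → t₀⁺} (y(t) − c_k)/|y(t) − c_k| and lim_{t → t₀⁻} (y(t) − c_k)/|y(t) − c_k| exist and are equal, then y(t₀ + t) = y(t₀ − t) for all t ∈ [0, δ]. -/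

import Mathlib

open Filter Topology

/-- A function with nonpositive derivative to the right of `0` that tends to `0` there is
nonpositive. -/
theorem eventually_nonpos_of_deriv_nonpos {f f' : ℝ → ℝ}
    (hf : ∀ᶠ t in 𝓝[>] (0 : ℝ), HasDerivAt f (f' t) t) (hf' : ∀ᶠ t in 𝓝[>] (0 : ℝ), f' t ≤ 0)
    (h0 : Tendsto f (𝓝[>] 0) (𝓝 0)) : ∀ᶠ t in 𝓝[>] (0 : ℝ), f t ≤ 0 := by
  obtain ⟨τ, hτ, hs⟩ := mem_nhdsGT_iff_exists_Ioo_subset.1 (hf.and hf')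
  have hanti : AntitoneOn f (Set.Ioo 0 τ) := by
    refine antitoneOn_of_deriv_nonpos (convex_Ioo 0 τ)
      (fun t ht => (hs ht).1.continuousAt.continuousWithinAt) ?_ ?_
    · rw [interior_Ioo]
      exact fun t ht => (hs ht).1.differentiableAt.differentiableWithinAt
    · rw [interior_Ioo]
      intro t ht
      rw [(hs ht).1.deriv]
      exact (hs ht).2
  filter_upwards [Ioo_mem_nhdsGT hτ] with t ht
  refine ge_of_tendsto h0 ?_
  filter_upwards [Ioo_mem_nhdsGT ht.1] with x hx
  exact hanti ⟨hx.1, hx.2.trans ht.2⟩ ht hx.2.le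

/-- Mean value inequality to the right of `0` for a curve and a bound that both tend to `0`. -/
theorem eventually_norm_le_of_norm_deriv_le {E : Type*} [NormedAddCommGroup E] [NormedSpace ℝ E]
    {f f' : ℝ → E} {B B' : ℝ → ℝ}
    (hf : ∀ᶠ t in 𝓝[>] (0 : ℝ), HasDerivAt f (f' t) t)
    (hB : ∀ᶠ t in 𝓝[>] (0 : ℝ), HasDerivAt B (B' t) t)
    (hle : ∀ᶠ t in 𝓝[>] (0 : ℝ), ‖f' t‖ ≤ B' t)
    (hf0 : Tendsto f (𝓝[>] 0) (𝓝 0)) (hB0 : Tendsto B (𝓝[>] 0) (𝓝 0)) :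
    ∀ᶠ t in 𝓝[>] (0 : ℝ), ‖f t‖ ≤ B t := by
  obtain ⟨τ, hτ, hs⟩ := mem_nhdsGT_iff_exists_Ioo_subset.1 (hf.and (hB.and hle))
  filter_upwards [Ioo_mem_nhdsGT hτ] with t ht
  have hsub : ∀ x ∈ Set.Ioo 0 t, ‖f t - f x‖ ≤ B t - B x := by
    intro x hx
    have hmem : ∀ z ∈ Set.Icc x t, z ∈ Set.Ioo 0 τ := fun z hz =>
      ⟨hx.1.trans_le hz.1, hz.2.trans_lt ht.2⟩
    exact image_norm_le_of_norm_deriv_right_le_deriv_boundary' (f := fun z => f z - f x)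
      (f' := f') (B := fun z => B z - B x) (B' := B') (a := x) (b := t)
      (fun z hz => ((hs (hmem z hz)).1.sub_const (f x)).continuousAt.continuousWithinAt)
      (fun z hz => ((hs (hmem z ⟨hz.1, hz.2.le⟩)).1.sub_const (f x)).hasDerivWithinAt)
      (by simp)
      (fun z hz => ((hs (hmem z hz)).2.1.sub_const (B x)).continuousAt.continuousWithinAt)
      (fun z hz => ((hs (hmem z ⟨hz.1, hz.2.le⟩)).2.1.sub_const (B x)).hasDerivWithinAt)
      (fun z hz => (hs (hmem z ⟨hz.1, hz.2.le⟩)).2.2)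
      (Set.right_mem_Icc.2 hx.2.le)
  have h1 : Tendsto (fun x => ‖f t - f x‖) (𝓝[>] 0) (𝓝 ‖f t - 0‖) :=
    (tendsto_const_nhds.sub hf0).norm
  have h2 : Tendsto (fun x => B t - B x) (𝓝[>] 0) (𝓝 (B t - 0)) := tendsto_const_nhds.sub hB0
  rw [sub_zero] at h1 h2
  refine le_of_tendsto_of_tendsto h1 h2 ?_
  filter_upwards [Ioo_mem_nhdsGT ht.1] with x hx using hsub x hx

theorem exists_primitive_nhdsGT {R : ℝ → ℝ} {L : ℝ}
    (hR : ∀ᶠ t in 𝓝[>] (0 : ℝ), ContinuousAt R t) (hL : Tendsto R (𝓝[>] 0) (𝓝 L)) :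
    ∃ A : ℝ → ℝ, Tendsto A (𝓝[>] 0) (𝓝 0) ∧ ∀ᶠ t in 𝓝[>] (0 : ℝ), HasDerivAt A (R t) t := by
  obtain ⟨τ, hτ, hs⟩ := mem_nhdsGT_iff_exists_Ioo_subset.1 hR
  have hτ2 : (0 : ℝ) < τ / 2 := half_pos hτ
  have hcont : ContinuousOn (extendFrom (Set.Ioo 0 (τ / 2)) R) (Set.Icc 0 (τ / 2)) := by
    have hmid : Tendsto R (𝓝[<] (τ / 2)) (𝓝 (R (τ / 2))) :=
      (hs ⟨hτ2, half_lt_self hτ⟩ : ContinuousAt R (τ / 2)).tendsto.mono_left nhdsWithin_le_nhds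
    exact continuousOn_Icc_extendFrom_Ioo
      (fun t ht => (hs ⟨ht.1, ht.2.trans (half_lt_self hτ)⟩ : ContinuousAt R t).continuousWithinAt)
      hL hmid
  have hE : Continuous (Set.IccExtend hτ2.le
      ((Set.Icc 0 (τ / 2)).domRestrict (extendFrom (Set.Ioo 0 (τ / 2)) R))) :=
    hcont.domRestrict.Icc_extend'
  have hd := fun t => (hE.integral_hasStrictDerivAt 0 t).hasDerivAt
  refine ⟨fun t => ∫ x in (0 : ℝ)..t, Set.IccExtend hτ2.le
      ((Set.Icc 0 (τ / 2)).domRestrict (extendFrom (Set.Ioo 0 (τ / 2)) R)) x, ?_, ?_⟩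
  · have := (hd 0).continuousAt.tendsto
    rw [intervalIntegral.integral_same] at this
    exact this.mono_left nhdsWithin_le_nhds
  · filter_upwards [Ioo_mem_nhdsGT hτ2] with t ht
    have hval : Set.IccExtend hτ2.le
        ((Set.Icc 0 (τ / 2)).domRestrict (extendFrom (Set.Ioo 0 (τ / 2)) R)) t = R t := by
      rw [Set.IccExtend_of_mem hτ2.le _ ⟨ht.1.le, ht.2.le⟩, Set.domRestrict_apply]
      exact extendFrom_eq (by rw [closure_Ioo hτ2.ne]; exact ⟨ht.1.le, ht.2.le⟩)
        (hs ⟨ht.1, ht.2.trans (half_lt_self hτ)⟩ : ContinuousAt R t).continuousWithinAt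
    have := hd t
    rwa [hval] at this

/-- A function with positive derivative to the right of `0` that tends to `0` there is positive. -/
theorem eventually_pos_of_deriv_pos {f f' : ℝ → ℝ}
    (hf : ∀ᶠ t in 𝓝[>] (0 : ℝ), HasDerivAt f (f' t) t) (hf' : ∀ᶠ t in 𝓝[>] (0 : ℝ), 0 < f' t)
    (h0 : Tendsto f (𝓝[>] 0) (𝓝 0)) : ∀ᶠ t in 𝓝[>] (0 : ℝ), 0 < f t := by
  obtain ⟨τ, hτ, hs⟩ := mem_nhdsGT_iff_exists_Ioo_subset.1 (hf.and hf')
  have hmono : StrictMonoOn f (Set.Ioo 0 τ) := by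
    refine strictMonoOn_of_deriv_pos (convex_Ioo 0 τ)
      (fun t ht => (hs ht).1.continuousAt.continuousWithinAt) ?_
    rw [interior_Ioo]
    intro t ht
    rw [(hs ht).1.deriv]
    exact (hs ht).2
  filter_upwards [Ioo_mem_nhdsGT hτ] with t ht
  have ht2 : t / 2 ∈ Set.Ioo 0 τ := ⟨half_pos ht.1, (half_lt_self ht.1).trans ht.2⟩
  refine lt_of_le_of_lt ?_ (hmono ht2 ht (half_lt_self ht.1))
  refine le_of_tendsto h0 ?_
  filter_upwards [Ioo_mem_nhdsGT ht2.1] with x hx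
  exact (hmono ⟨hx.1, hx.2.trans ht2.2⟩ ht2 hx.2).le

/-- `y`, with velocity `v`, is an ejection from a collision at the origin at time `0`: for small
positive times it solves `ÿ = -m y / |y|³ + g(y)` with energy
`|ẏ|² / 2 - m / |y| - W(y) = h`, and it tends to the origin. -/
structure IsEjection (m h : ℝ) (W : ℂ → ℝ) (g : ℂ → ℂ) (y v : ℝ → ℂ) : Prop where
  ne_zero : ∀ᶠ t in 𝓝[>] (0 : ℝ), y t ≠ 0
  hasDerivAt : ∀ᶠ t in 𝓝[>] (0 : ℝ), HasDerivAt y (v t) t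
  hasDerivAt_velocity : ∀ᶠ t in 𝓝[>] (0 : ℝ),
    HasDerivAt v (-((m : ℂ) * y t / ((‖y t‖ ^ 3 : ℝ) : ℂ)) + g (y t)) t
  energy : ∀ᶠ t in 𝓝[>] (0 : ℝ), ‖v t‖ ^ 2 = 2 * (m / ‖y t‖ + W (y t) + h)
  tendsto : Tendsto y (𝓝[>] 0) (𝓝 0)

/-- The right-hand side of the Levi-Civita regularized equation `q'' = F(q)`. -/
noncomputable def leviCivitaForce (h : ℝ) (W : ℂ → ℝ) (g : ℂ → ℂ) (q : ℂ) : ℂ :=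
  q * ((W (q ^ 2) + h : ℝ) : ℂ) / 2 + ((‖q‖ ^ 2 : ℝ) : ℂ) * (starRingEnd ℂ) q * g (q ^ 2) / 2

theorem contDiffAt_leviCivitaForce {h : ℝ} {W : ℂ → ℝ} {g : ℂ → ℂ} (hW : ContDiffAt ℝ 1 W 0)
    (hg : ContDiffAt ℝ 1 g 0) : ContDiffAt ℝ 1 (leviCivitaForce h W g) 0 := by
  have hsq : ContDiffAt ℝ 1 (fun q : ℂ => q ^ 2) 0 := contDiffAt_id.pow 2
  have hW' : ContDiffAt ℝ 1 (fun q : ℂ => W (q ^ 2)) 0 :=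
    ContDiffAt.comp (0 : ℂ) (g := W) (by simpa using hW) hsq
  have hg' : ContDiffAt ℝ 1 (fun q : ℂ => g (q ^ 2)) 0 :=
    ContDiffAt.comp (0 : ℂ) (g := g) (by simpa using hg) hsq
  have h1 : ContDiffAt ℝ 1 (fun q : ℂ => ((W (q ^ 2) + h : ℝ) : ℂ)) 0 :=
    Complex.ofRealCLM.contDiff.contDiffAt.comp 0 (hW'.add contDiffAt_const)
  have h2 : ContDiffAt ℝ 1 (fun q : ℂ => ((‖q‖ ^ 2 : ℝ) : ℂ)) 0 :=
    Complex.ofRealCLM.contDiff.contDiffAt.comp 0 (contDiff_norm_sq ℝ).contDiffAt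
  have h3 : ContDiffAt ℝ 1 (fun q : ℂ => (starRingEnd ℂ) q) 0 :=
    Complex.conjCLE.contDiff.contDiffAt
  exact ((contDiffAt_id.mul h1).div_const 2).add (((h2.mul h3).mul hg').div_const 2)

namespace IsEjection

variable {m h : ℝ} {W : ℂ → ℝ} {g : ℂ → ℂ} {y v : ℝ → ℂ}

theorem tendsto_norm_mul_norm_sq (H : IsEjection m h W g y v) (hW : ContinuousAt W 0) :
    Tendsto (fun t => ‖y t‖ * ‖v t‖ ^ 2) (𝓝[>] 0) (𝓝 (2 * m)) := by
  have h1 : Tendsto (fun t => 2 * (m + ‖y t‖ * (W (y t) + h))) (𝓝[>] 0)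
      (𝓝 (2 * (m + ‖(0 : ℂ)‖ * (W 0 + h)))) :=
    (tendsto_const_nhds.add
      (H.tendsto.norm.mul ((hW.tendsto.comp H.tendsto).add_const h))).const_mul 2
  simp only [norm_zero, zero_mul, add_zero] at h1
  refine h1.congr' ?_
  filter_upwards [H.ne_zero, H.energy] with t h0 hE
  have := norm_ne_zero_iff.2 h0
  rw [hE]
  field_simp
  ring

/-- A continuous branch of the square root along an ejection with limiting direction `w ^ 2`. -/
theorem exists_sqrt (H : IsEjection m h W g y v) {w : ℂ} (hw : ‖w‖ = 1)
    (hu : Tendsto (fun t => y t / ((‖y t‖ : ℝ) : ℂ)) (𝓝[>] 0) (𝓝 (w ^ 2))) :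
    ∃ q : ℝ → ℂ, Tendsto (fun t => q t / ((‖q t‖ : ℝ) : ℂ)) (𝓝[>] 0) (𝓝 w) ∧
      (∀ t, q t ^ 2 = y t) ∧ ∀ᶠ t in 𝓝[>] (0 : ℝ), HasDerivAt q (v t / (2 * q t)) t := by
  have hw0 : w ≠ 0 := norm_ne_zero_iff.1 (by rw [hw]; exact one_ne_zero)
  have hsq : ∀ z : ℂ, z.sqrt ^ 2 = z := fun z => by
    rw [Complex.sqrt]; exact_mod_cast Complex.cpow_nat_inv_pow z two_ne_zero
  have hq2 : ∀ t, (w * (y t / w ^ 2).sqrt) ^ 2 = y t := fun t => by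
    rw [mul_pow, hsq]; field_simp
  have hone : Tendsto (fun t => y t / ((‖y t‖ : ℝ) : ℂ) / w ^ 2) (𝓝[>] 0) (𝓝 1) := by
    have := hu.div_const (w ^ 2)
    rwa [div_self (pow_ne_zero 2 hw0)] at this
  refine ⟨fun t => w * (y t / w ^ 2).sqrt, ?_, hq2, ?_⟩
  · set e : ℝ → ℂ := fun t => (y t / w ^ 2).sqrt / ((‖(y t / w ^ 2).sqrt‖ : ℝ) : ℂ) with he
    have he2 : ∀ t, e t ^ 2 = y t / ((‖y t‖ : ℝ) : ℂ) / w ^ 2 := fun t => by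
      have hn : ‖(y t / w ^ 2).sqrt‖ ^ 2 = ‖y t‖ := by
        rw [← norm_pow, hsq, norm_div, norm_pow, hw]; simp
      rw [he]
      simp only [div_pow, hsq]
      rw [← Complex.ofReal_pow, hn]
      ring
    have hre : ∀ t, 0 ≤ (e t).re := fun t => by
      rw [he]
      simp only [Complex.div_ofReal_re]
      refine div_nonneg ?_ (norm_nonneg _)
      rw [Complex.sqrt, Complex.cpow_inv_two_re]
      exact Real.sqrt_nonneg _
    have hbound : ∀ t, ‖e t - 1‖ ≤ ‖e t ^ 2 - 1‖ := fun t => by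
      have h1 : 1 ≤ ‖e t + 1‖ := by
        refine le_trans ?_ (Complex.re_le_norm _)
        simpa using hre t
      have h2 : e t ^ 2 - 1 = (e t - 1) * (e t + 1) := by ring
      rw [h2, norm_mul]
      exact le_mul_of_one_le_right (norm_nonneg _) h1
    have hlim : Tendsto e (𝓝[>] 0) (𝓝 1) := by
      rw [tendsto_iff_norm_sub_tendsto_zero]
      refine squeeze_zero (fun t => norm_nonneg _) hbound ?_
      simp only [he2]
      exact tendsto_iff_norm_sub_tendsto_zero.1 hone
    have := hlim.const_mul w
    rw [mul_one] at this
    refine this.congr fun t => ?_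
    rw [he]
    simp only [norm_mul, hw, one_mul]
    ring
  · have hre : ∀ᶠ t in 𝓝[>] (0 : ℝ), 0 < (y t / ((‖y t‖ : ℝ) : ℂ) / w ^ 2).re :=
      (Complex.continuous_re.tendsto _).comp hone |>.eventually_const_lt (by simp)
    filter_upwards [hre, H.ne_zero, H.hasDerivAt] with t h1 h0 hd
    have hpos : 0 < ‖y t‖ := norm_pos_iff.2 h0
    have hslit : y t / w ^ 2 ∈ Complex.slitPlane := by
      left
      rw [div_right_comm, Complex.div_ofReal_re] at h1
      exact (div_pos_iff_of_pos_right hpos).1 h1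
    have hd1 := ((Complex.hasDerivAt_sqrt hslit).scomp t (hd.div_const (w ^ 2))).const_mul w
    have hne : w * (y t / w ^ 2).sqrt ≠ 0 := fun h0' => h0 <| by
      rw [← hq2 t, h0']; ring
    have hd2 := (hd1.fun_pow 2).congr_of_eventuallyEq (f₁ := y)
      (Eventually.of_forall fun x => (hq2 x).symm)
    have hv := hd.unique hd2
    have hd3 : HasDerivAt (fun t => w * (y t / w ^ 2).sqrt) _ t := hd1
    convert! hd3 using 1
    rw [div_eq_iff (mul_ne_zero two_ne_zero hne)]
    refine hv.trans ?_
    simp only [Function.comp]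
    push_cast
    ring

/-- The Sundman time `∫ dt / |y|` converges at a collision. -/
theorem exists_sundman_time (H : IsEjection m h W g y v) (hm : 0 < m) (hW : ContDiffAt ℝ 1 W 0)
    (hg : ContDiffAt ℝ 1 g 0) :
    ∃ s : ℝ → ℝ, Tendsto s (𝓝[>] 0) (𝓝[>] 0) ∧
      ∀ᶠ t in 𝓝[>] (0 : ℝ), HasDerivAt s ‖y t‖⁻¹ t := by
  have hρ : ContinuousAt (fun z => 2 * (W z + h) + ((starRingEnd ℂ) z * g z).re) 0 :=
    ((hW.continuousAt.add continuousAt_const).const_mul 2).add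
      (Complex.continuous_re.continuousAt.comp
        (Complex.continuous_conj.continuousAt.mul hg.continuousAt))
  have hρev : ∀ᶠ z in 𝓝 (0 : ℂ),
      ContinuousAt (fun z => 2 * (W z + h) + ((starRingEnd ℂ) z * g z).re) z := by
    filter_upwards [hW.eventually (by simp), hg.eventually (by simp)] with z h1 h2
    exact ((h1.continuousAt.add continuousAt_const).const_mul 2).add
      (Complex.continuous_re.continuousAt.comp
        (Complex.continuous_conj.continuousAt.mul h2.continuousAt))
  obtain ⟨A, hA0, hA⟩ := exists_primitive_nhdsGT
    (R := fun t => 2 * (W (y t) + h) + ((starRingEnd ℂ) (y t) * g (y t)).re)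
    (by
      filter_upwards [H.tendsto.eventually hρev, H.hasDerivAt] with t h1 h2
      exact ContinuousAt.comp (f := y) h1 h2.continuousAt)
    (hρ.tendsto.comp H.tendsto)
  set s : ℝ → ℝ := fun t => (((starRingEnd ℂ) (y t) * v t).re - A t) / m with hs
  have hsd : ∀ᶠ t in 𝓝[>] (0 : ℝ), HasDerivAt s ‖y t‖⁻¹ t := by
    filter_upwards [H.ne_zero, H.hasDerivAt, H.hasDerivAt_velocity, H.energy, hA] with
      t h0 hd hd2 hE hAt
    have hJ := Complex.reCLM.hasFDerivAt.comp_hasDerivAt t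
      ((Complex.conjCLE.hasFDerivAt.comp_hasDerivAt t hd).mul hd2)
    have hJ' : HasDerivAt s _ t := (hJ.sub hAt).div_const m
    convert! hJ' using 1
    have hn : (0 : ℝ) < ‖y t‖ := norm_pos_iff.2 h0
    have hvv : ((starRingEnd ℂ) (v t) * v t).re = ‖v t‖ ^ 2 := by
      rw [mul_comm, Complex.mul_conj, Complex.ofReal_re, Complex.normSq_eq_norm_sq]
    have hyy : ((starRingEnd ℂ) (y t) * ((m : ℂ) * y t / ((‖y t‖ ^ 3 : ℝ) : ℂ))).re
        = m / ‖y t‖ := by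
      have : (starRingEnd ℂ) (y t) * ((m : ℂ) * y t / ((‖y t‖ ^ 3 : ℝ) : ℂ))
          = ((m * ‖y t‖ ^ 2 / ‖y t‖ ^ 3 : ℝ) : ℂ) := by
        rw [← Complex.normSq_eq_norm_sq]
        push_cast
        rw [← Complex.mul_conj]
        ring
      rw [this, Complex.ofReal_re]
      field_simp
    simp only [Function.comp, Complex.reCLM_apply, Complex.conjCLE_apply,
      ContinuousLinearEquiv.coe_coe, mul_add, mul_neg, Complex.add_re, Complex.neg_re, hvv, hyy, hE]
    field_simp
    ring
  have hJ0 : Tendsto (fun t => ((starRingEnd ℂ) (y t) * v t).re) (𝓝[>] 0) (𝓝 0) := by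
    have h1 := (H.tendsto.norm.mul (H.tendsto_norm_mul_norm_sq hW.continuousAt)).sqrt
    simp only [norm_zero, zero_mul, Real.sqrt_zero] at h1
    refine squeeze_zero_norm (fun t => ?_) h1
    refine (Complex.abs_re_le_norm _).trans (Real.le_sqrt_of_sq_le (le_of_eq ?_))
    rw [norm_mul, RCLike.norm_conj]
    ring
  have hs0 : Tendsto s (𝓝[>] 0) (𝓝 0) := by
    have := (hJ0.sub hA0).div_const m
    rwa [sub_zero, zero_div] at this
  refine ⟨s, ?_, hsd⟩
  rw [tendsto_nhdsWithin_iff]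
  refine ⟨hs0, eventually_pos_of_deriv_pos hsd ?_ hs0⟩
  filter_upwards [H.ne_zero] with t h0 using inv_pos.2 (norm_pos_iff.2 h0)

end IsEjection

/-- Levi-Civita regularization of an ejection: `y = q ^ 2`, with Sundman time `s` and regularized
velocity `p = dq / ds`. -/
theorem IsEjection.exists_regularization {m h : ℝ} {W : ℂ → ℝ} {g : ℂ → ℂ} {y v : ℝ → ℂ}
    (H : IsEjection m h W g y v) (hm : 0 < m) (hW : ContDiffAt ℝ 1 W 0)
    (hg : ContDiffAt ℝ 1 g 0) {w : ℂ} (hw : ‖w‖ = 1)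
    (hu : Tendsto (fun t => y t / ((‖y t‖ : ℝ) : ℂ)) (𝓝[>] 0) (𝓝 (w ^ 2))) :
    ∃ (q p : ℝ → ℂ) (s : ℝ → ℝ), (∀ t, q t ^ 2 = y t) ∧ Tendsto s (𝓝[>] 0) (𝓝[>] 0) ∧
      Tendsto q (𝓝[>] 0) (𝓝 0) ∧ Tendsto p (𝓝[>] 0) (𝓝 (√(m / 2) * w)) ∧
      (∀ᶠ t in 𝓝[>] (0 : ℝ), q t ≠ 0) ∧
      (∀ᶠ t in 𝓝[>] (0 : ℝ), HasDerivAt s (‖q t‖ ^ 2)⁻¹ t) ∧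
      (∀ᶠ t in 𝓝[>] (0 : ℝ), HasDerivAt q ((‖q t‖ ^ 2)⁻¹ • p t) t) ∧
      ∀ᶠ t in 𝓝[>] (0 : ℝ),
        HasDerivAt p ((‖q t‖ ^ 2)⁻¹ • leviCivitaForce h W g (q t)) t := by
  obtain ⟨q, hqdir, hq2, hqd⟩ := H.exists_sqrt hw hu
  obtain ⟨s, hs0, hsd⟩ := H.exists_sundman_time hm hW hg
  have hnq : ∀ t, ‖q t‖ ^ 2 = ‖y t‖ := fun t => by rw [← norm_pow, hq2]
  have hqne : ∀ᶠ t in 𝓝[>] (0 : ℝ), q t ≠ 0 := by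
    filter_upwards [H.ne_zero] with t h0 hq
    exact h0 (by rw [← hq2, hq]; ring)
  have hq0 : Tendsto q (𝓝[>] 0) (𝓝 0) := by
    rw [tendsto_zero_iff_norm_tendsto_zero]
    have := H.tendsto.norm.sqrt
    simp only [← hnq, norm_zero, Real.sqrt_zero, Real.sqrt_sq (norm_nonneg _)] at this
    exact this
  set p : ℝ → ℂ := fun t => (starRingEnd ℂ) (q t) * v t / 2 with hp
  have hsd' : ∀ᶠ t in 𝓝[>] (0 : ℝ), HasDerivAt s (‖q t‖ ^ 2)⁻¹ t := by
    simpa only [hnq] using hsd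
  have hqd' : ∀ᶠ t in 𝓝[>] (0 : ℝ), HasDerivAt q ((‖q t‖ ^ 2)⁻¹ • p t) t := by
    filter_upwards [hqd, hqne] with t hd h0
    convert! hd using 1
    have hc : (starRingEnd ℂ) (q t) ≠ 0 := by simpa using h0
    rw [Complex.real_smul, ← Complex.normSq_eq_norm_sq]
    push_cast
    rw [← Complex.mul_conj, hp]
    field_simp
  have hpd : ∀ᶠ t in 𝓝[>] (0 : ℝ),
      HasDerivAt p ((‖q t‖ ^ 2)⁻¹ • leviCivitaForce h W g (q t)) t := by
    filter_upwards [hqd, hqne, H.hasDerivAt_velocity, H.energy] with t hd h0 hd2 hE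
    have hd3 : HasDerivAt p _ t :=
      ((Complex.conjCLE.hasFDerivAt.comp_hasDerivAt t hd).mul hd2).div_const 2
    convert! hd3 using 1
    have hc : (starRingEnd ℂ) (q t) ≠ 0 := by simpa using h0
    have hvv : (starRingEnd ℂ) (v t) * v t
        = 2 * (m / (q t * (starRingEnd ℂ) (q t)) + ((W (y t) + h : ℝ) : ℂ)) := by
      rw [mul_comm, Complex.mul_conj, Complex.mul_conj, Complex.normSq_eq_norm_sq,
        Complex.normSq_eq_norm_sq, hE, hnq]
      push_cast
      ring
    have hr : ((‖q t‖ : ℝ) : ℂ) ^ 2 = q t * (starRingEnd ℂ) (q t) := by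
      rw [Complex.mul_conj, Complex.normSq_eq_norm_sq, Complex.ofReal_pow]
    have hr6 : ((‖q t‖ : ℝ) : ℂ) ^ 6 = (q t * (starRingEnd ℂ) (q t)) ^ 3 := by
      rw [← hr]; ring
    simp only [Function.comp, Complex.conjCLE_apply, ContinuousLinearEquiv.coe_coe, map_div₀,
      map_mul, map_ofNat, leviCivitaForce, Complex.real_smul, hq2, ← hnq]
    push_cast at hvv ⊢
    rw [div_mul_eq_mul_div _ _ (v t), hvv, ← pow_mul, hr6, hr, ← hq2]
    field_simp
    ring
  have hpn : Tendsto (fun t => ‖p t‖) (𝓝[>] 0) (𝓝 √(m / 2)) := by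
    have h1 := ((H.tendsto_norm_mul_norm_sq hW.continuousAt).div_const 4).sqrt
    rw [show 2 * m / 4 = m / 2 by ring] at h1
    refine h1.congr fun t => ?_
    rw [Real.sqrt_eq_iff_mul_self_eq (by positivity) (norm_nonneg _), hp, ← hnq]
    simp only [norm_div, norm_mul, RCLike.norm_conj, Complex.norm_ofNat]
    ring
  have hF : ContinuousAt (leviCivitaForce h W g) 0 := (contDiffAt_leviCivitaForce hW hg).continuousAt
  have hs0' : Tendsto s (𝓝[>] 0) (𝓝 0) := hs0.mono_right nhdsWithin_le_nhds
  have hspos : ∀ᶠ t in 𝓝[>] (0 : ℝ), 0 < s t := hs0.eventually self_mem_nhdsWithin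
  obtain ⟨K, hK⟩ : ∃ K : ℝ, ∀ᶠ t in 𝓝[>] (0 : ℝ), ‖leviCivitaForce h W g (q t)‖ ≤ K :=
    ⟨_, (hF.norm.tendsto.comp hq0).eventually_le_const (lt_add_one _)⟩
  have hps : Tendsto (fun t => s t • p t) (𝓝[>] 0) (𝓝 0) := by
    rw [tendsto_zero_iff_norm_tendsto_zero]
    have := hs0'.norm.mul hpn
    rw [norm_zero, zero_mul] at this
    exact this.congr fun t => (norm_smul _ _).symm
  have hM : ∀ᶠ t in 𝓝[>] (0 : ℝ), ‖q t - s t • p t‖ ≤ K / 2 * s t ^ 2 := by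
    refine eventually_norm_le_of_norm_deriv_le
      (f' := fun t => -(s t • ((‖q t‖ ^ 2)⁻¹ • leviCivitaForce h W g (q t))))
      (B' := fun t => K / 2 * (2 * s t * (‖q t‖ ^ 2)⁻¹)) ?_ ?_ ?_ ?_ ?_
    · filter_upwards [hsd', hqd', hpd] with t h1 h2 h3
      have := h2.sub (h1.smul h3)
      convert! this using 1
      abel
    · filter_upwards [hsd'] with t h1
      simpa using (h1.fun_pow 2).const_mul (K / 2)
    · filter_upwards [hK, hspos] with t h1 h2
      rw [norm_neg, norm_smul, norm_smul, Real.norm_of_nonneg h2.le,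
        Real.norm_of_nonneg (by positivity)]
      calc s t * ((‖q t‖ ^ 2)⁻¹ * ‖leviCivitaForce h W g (q t)‖)
          ≤ s t * ((‖q t‖ ^ 2)⁻¹ * K) := by gcongr
        _ = _ := by ring
    · simpa using hq0.sub hps
    · simpa using (hs0'.pow 2).const_mul (K / 2)
  have hdiff : Tendsto (fun t => (s t)⁻¹ • q t - p t) (𝓝[>] 0) (𝓝 0) := by
    refine squeeze_zero_norm' (a := fun t => K / 2 * s t) ?_ (by simpa using hs0'.const_mul (K / 2))
    filter_upwards [hM, hspos] with t h1 h2
    have : (s t)⁻¹ • q t - p t = (s t)⁻¹ • (q t - s t • p t) := by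
      rw [smul_sub, inv_smul_smul₀ h2.ne']
    rw [this, norm_smul, norm_inv, Real.norm_of_nonneg h2.le, inv_mul_le_iff₀ h2]
    linarith
  have hnorm : Tendsto (fun t => ‖(s t)⁻¹ • q t‖) (𝓝[>] 0) (𝓝 √(m / 2)) := by
    have h1 : Tendsto (fun t => ‖(s t)⁻¹ • q t‖ - ‖p t‖) (𝓝[>] 0) (𝓝 0) :=
      squeeze_zero_norm (fun t => abs_norm_sub_norm_le _ _)
        (tendsto_zero_iff_norm_tendsto_zero.1 hdiff)
    simpa using h1.add hpn
  have hqs : Tendsto (fun t => (s t)⁻¹ • q t) (𝓝[>] 0) (𝓝 (√(m / 2) * w)) := by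
    refine (((Complex.continuous_ofReal.tendsto _).comp hnorm).mul hqdir).congr' ?_
    filter_upwards [hqne, hspos] with t h1 h2
    have : ((‖q t‖ : ℝ) : ℂ) ≠ 0 := by simpa using h1
    rw [Function.comp, norm_smul, norm_inv, Real.norm_of_nonneg h2.le, Complex.real_smul]
    push_cast
    field_simp
  exact ⟨q, p, s, hq2, hs0, hq0, by simpa using hqs.sub hdiff, hqne, hsd', hqd', hpd⟩

/-- Two solutions of the regularized equation, one of them given in a time `t` with
`ds / dt = r(t)`, agree as soon as they have the same initial data at the singular time `t = 0`. -/
theorem eventually_eq_comp_of_hasDerivAt {F : ℂ → ℂ} (hF : ContDiffAt ℝ 1 F 0)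
    {Q P q p : ℝ → ℂ} {s r : ℝ → ℝ}
    (hQ : ∀ᶠ σ in 𝓝 (0 : ℝ), HasDerivAt Q (P σ) σ ∧ HasDerivAt P (F (Q σ)) σ) (hQ0 : Q 0 = 0)
    (hs0 : Tendsto s (𝓝[>] 0) (𝓝 0)) (hq0 : Tendsto q (𝓝[>] 0) (𝓝 0))
    (hp0 : Tendsto p (𝓝[>] 0) (𝓝 (P 0))) (hr : ∀ t, 0 ≤ r t)
    (hs : ∀ᶠ t in 𝓝[>] (0 : ℝ), HasDerivAt s (r t) t)
    (hq : ∀ᶠ t in 𝓝[>] (0 : ℝ), HasDerivAt q (r t • p t) t)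
    (hp : ∀ᶠ t in 𝓝[>] (0 : ℝ), HasDerivAt p (r t • F (q t)) t) :
    ∀ᶠ t in 𝓝[>] (0 : ℝ), q t = Q (s t) := by
  obtain ⟨K, S, hS, hK⟩ := hF.exists_lipschitzOnWith
  have hQs : Tendsto (fun t => Q (s t)) (𝓝[>] 0) (𝓝 0) := by
    have := hQ.self_of_nhds.1.continuousAt.tendsto.comp hs0
    rwa [hQ0] at this
  have hPs : Tendsto (fun t => P (s t)) (𝓝[>] 0) (𝓝 (P 0)) :=
    hQ.self_of_nhds.2.continuousAt.tendsto.comp hs0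
  set a : ℝ → ℂ := fun t => q t - Q (s t) with ha
  set b : ℝ → ℂ := fun t => p t - P (s t) with hb
  have hnonpos : ∀ᶠ t in 𝓝[>] (0 : ℝ),
      (‖a t‖ ^ 2 + ‖b t‖ ^ 2) * Real.exp (-(1 + K) * s t) ≤ 0 := by
    refine eventually_nonpos_of_deriv_nonpos (f' := fun t =>
      (2 * inner ℝ (a t) (r t • b t) + 2 * inner ℝ (b t) (r t • (F (q t) - F (Q (s t))))) *
        Real.exp (-(1 + K) * s t) +
      (‖a t‖ ^ 2 + ‖b t‖ ^ 2) * (Real.exp (-(1 + K) * s t) * (-(1 + K) * r t))) ?_ ?_ ?_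
    · filter_upwards [hs, hq, hp, hs0.eventually hQ] with t h1 h2 h3 h4
      have ha' : HasDerivAt a (r t • b t) t := by
        rw [hb, smul_sub]
        exact h2.sub (h4.1.scomp t h1)
      have hb' : HasDerivAt b (r t • (F (q t) - F (Q (s t)))) t := by
        rw [smul_sub]
        exact h3.sub (h4.2.scomp t h1)
      exact (ha'.norm_sq.add hb'.norm_sq).mul (h1.const_mul (-(1 + K : ℝ))).exp
    · filter_upwards [hq0.eventually hS, hQs.eventually hS] with t h1 h2
      have hlip : ‖F (q t) - F (Q (s t))‖ ≤ K * ‖a t‖ := hK.norm_sub_le h1 h2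
      have h3 : inner ℝ (a t) (b t) ≤ ‖a t‖ * ‖b t‖ := real_inner_le_norm _ _
      have h4 : inner ℝ (b t) (F (q t) - F (Q (s t))) ≤ ‖b t‖ * (K * ‖a t‖) :=
        (real_inner_le_norm _ _).trans (mul_le_mul_of_nonneg_left hlip (norm_nonneg _))
      have h5 : 2 * inner ℝ (a t) (b t) + 2 * inner ℝ (b t) (F (q t) - F (Q (s t)))
          - (1 + K) * (‖a t‖ ^ 2 + ‖b t‖ ^ 2) ≤ 0 := by
        have : 0 ≤ (1 + (K : ℝ)) * (‖a t‖ - ‖b t‖) ^ 2 := by positivity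
        linarith
      have h6 := mul_nonpos_of_nonneg_of_nonpos
        (mul_nonneg (hr t) (Real.exp_pos (-(1 + K) * s t)).le) h5
      rw [real_inner_smul_right, real_inner_smul_right]
      linarith
    · have h1 : Tendsto a (𝓝[>] 0) (𝓝 0) := by simpa using hq0.sub hQs
      have h2 : Tendsto b (𝓝[>] 0) (𝓝 0) := by simpa using hp0.sub hPs
      simpa using ((h1.norm.pow 2).add (h2.norm.pow 2)).mul (hs0.const_mul (-(1 + K : ℝ))).rexp
  filter_upwards [hnonpos] with t ht
  have h1 := nonpos_of_mul_nonpos_left ht (Real.exp_pos _)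
  have h2 : ‖a t‖ ^ 2 = 0 :=
    le_antisymm (by linarith [sq_nonneg ‖b t‖]) (sq_nonneg _)
  exact sub_eq_zero.1 (norm_eq_zero.1 (pow_eq_zero_iff two_ne_zero |>.1 h2))

/-- Two ejections with the same energy and the same limiting direction coincide. -/
theorem IsEjection.eventually_eq {m h : ℝ} {W : ℂ → ℝ} {g : ℂ → ℂ} {y₁ v₁ y₂ v₂ : ℝ → ℂ}
    (H₁ : IsEjection m h W g y₁ v₁) (H₂ : IsEjection m h W g y₂ v₂) (hm : 0 < m)
    (hW : ContDiffAt ℝ 1 W 0) (hg : ContDiffAt ℝ 1 g 0) {u : ℂ}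
    (hu₁ : Tendsto (fun t => y₁ t / ((‖y₁ t‖ : ℝ) : ℂ)) (𝓝[>] 0) (𝓝 u))
    (hu₂ : Tendsto (fun t => y₂ t / ((‖y₂ t‖ : ℝ) : ℂ)) (𝓝[>] 0) (𝓝 u)) :
    ∀ᶠ t in 𝓝[>] (0 : ℝ), y₁ t = y₂ t := by
  have hunorm : ‖u‖ = 1 := by
    refine tendsto_nhds_unique hu₁.norm (tendsto_const_nhds.congr' ?_)
    filter_upwards [H₁.ne_zero] with t h0
    simp [h0]
  obtain ⟨w, rfl⟩ : ∃ w : ℂ, w ^ 2 = u := IsAlgClosed.exists_pow_nat_eq u two_pos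
  have hw : ‖w‖ = 1 := by
    rwa [norm_pow, pow_eq_one_iff_of_nonneg (norm_nonneg _) two_ne_zero] at hunorm
  have hF := contDiffAt_leviCivitaForce (h := h) hW hg
  set F := leviCivitaForce h W g
  set p₀ : ℂ := √(m / 2) * w with hp₀
  have hp₀' : p₀ ≠ 0 := by
    rw [← norm_ne_zero_iff, hp₀, norm_mul, hw, mul_one, Complex.norm_real, norm_ne_zero_iff]
    positivity
  obtain ⟨γ, hγ0, ε, hε, hγ⟩ :=
    ContDiffAt.exists_forall_mem_closedBall_exists_eq_forall_mem_Ioo_hasDerivAt₀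
      (f := fun z : ℂ × ℂ × ℝ => (z.2.1, F z.1, ‖z.1‖ ^ 2)) (x₀ := (0, p₀, 0))
      (by
        refine ContDiffAt.prodMk (by fun_prop) (ContDiffAt.prodMk ?_ ?_)
        · exact ContDiffAt.comp (g := F) (0, p₀, 0) hF contDiffAt_fst
        · exact contDiffAt_fst.norm_sq ℝ) 0
  rw [zero_sub, zero_add] at hγ
  have hIoo : Set.Ioo (-ε) ε ∈ 𝓝 (0 : ℝ) := Ioo_mem_nhds (neg_lt_zero.2 hε) hε
  set Q : ℝ → ℂ := fun σ => (γ σ).1 with hQdef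
  set P : ℝ → ℂ := fun σ => (γ σ).2.1 with hPdef
  set T : ℝ → ℝ := fun σ => (γ σ).2.2 with hTdef
  have hQ0 : Q 0 = 0 := by simp [hQdef, hγ0]
  have hP0 : P 0 = p₀ := by simp [hPdef, hγ0]
  have hT0 : T 0 = 0 := by simp [hTdef, hγ0]
  have hQd : ∀ σ ∈ Set.Ioo (-ε) ε, HasDerivAt Q (P σ) σ := fun σ hσ =>
    (ContinuousLinearMap.fst ℝ ℂ (ℂ × ℝ)).hasFDerivAt.comp_hasDerivAt σ (hγ σ hσ)
  have hPd : ∀ σ ∈ Set.Ioo (-ε) ε, HasDerivAt P (F (Q σ)) σ := fun σ hσ =>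
    ((ContinuousLinearMap.fst ℝ ℂ ℝ).comp
      (ContinuousLinearMap.snd ℝ ℂ (ℂ × ℝ))).hasFDerivAt.comp_hasDerivAt σ (hγ σ hσ)
  have hTd : ∀ σ ∈ Set.Ioo (-ε) ε, HasDerivAt T (‖Q σ‖ ^ 2) σ := fun σ hσ =>
    ((ContinuousLinearMap.snd ℝ ℂ ℝ).comp
      (ContinuousLinearMap.snd ℝ ℂ (ℂ × ℝ))).hasFDerivAt.comp_hasDerivAt σ (hγ σ hσ)
  have hQne : ∀ᶠ σ in 𝓝[>] (0 : ℝ), Q σ ≠ 0 := by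
    have h0 := hQd 0 (mem_of_mem_nhds hIoo)
    rw [hP0] at h0
    exact (h0.eventually_ne hp₀').filter_mono (nhdsWithin_mono 0 fun _ h => ne_of_gt h)
  obtain ⟨η, hη, hηs⟩ := mem_nhdsGT_iff_exists_Ioo_subset.1
    (hQne.and (nhdsWithin_le_nhds hIoo))
  have hTmono : StrictMonoOn T (Set.Ioo 0 η) := by
    refine strictMonoOn_of_deriv_pos (convex_Ioo 0 η)
      (fun σ hσ => (hTd σ (hηs hσ).2).continuousAt.continuousWithinAt) ?_
    rw [interior_Ioo]
    intro σ hσ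
    rw [(hTd σ (hηs hσ).2).deriv]
    have := norm_pos_iff.2 (hηs hσ).1
    positivity
  have key : ∀ {y v : ℝ → ℂ}, IsEjection m h W g y v →
      Tendsto (fun t => y t / ((‖y t‖ : ℝ) : ℂ)) (𝓝[>] 0) (𝓝 (w ^ 2)) →
      ∃ s : ℝ → ℝ, (∀ᶠ t in 𝓝[>] (0 : ℝ), s t ∈ Set.Ioo 0 η) ∧
        (∀ᶠ t in 𝓝[>] (0 : ℝ), y t = Q (s t) ^ 2) ∧ ∀ᶠ t in 𝓝[>] (0 : ℝ), T (s t) = t := by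
    intro y v H hu
    obtain ⟨q, p, s, hq2, hs0, hq0, hp0, hqne, hsd, hqd, hpd⟩ :=
      H.exists_regularization hm hW hg hw hu
    have hs0' : Tendsto s (𝓝[>] 0) (𝓝 0) := hs0.mono_right nhdsWithin_le_nhds
    have hqQ := eventually_eq_comp_of_hasDerivAt hF
      (by filter_upwards [hIoo] with σ hσ using ⟨hQd σ hσ, hPd σ hσ⟩) hQ0 hs0' hq0
      (by rwa [hP0]) (fun t => by positivity) hsd hqd hpd
    refine ⟨s, hs0.eventually (Ioo_mem_nhdsGT hη), ?_, ?_⟩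
    · filter_upwards [hqQ] with t ht
      rw [← ht, hq2]
    · have hlim : Tendsto (fun t => T (s t) - t) (𝓝[>] 0) (𝓝 0) := by
        have h1 := (hTd 0 (mem_of_mem_nhds hIoo)).continuousAt.tendsto.comp hs0'
        rw [hT0] at h1
        simpa using h1.sub (tendsto_id.mono_left nhdsWithin_le_nhds)
      have := eventually_norm_le_of_norm_deriv_le (f := fun t => T (s t) - t) (f' := fun _ => 0)
        (B := fun _ => 0) (B' := fun _ => 0) ?_
        (Eventually.of_forall fun t => hasDerivAt_const t 0)
        (Eventually.of_forall fun t => by simp) hlim tendsto_const_nhds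
      · filter_upwards [this] with t ht
        exact sub_eq_zero.1 (norm_le_zero_iff.1 ht)
      · filter_upwards [hsd, hs0'.eventually hIoo, hqQ, hqne] with t h1 h2 h3 h4
        have h5 := ((hTd _ h2).comp t h1).sub (hasDerivAt_id t)
        rw [← h3, mul_inv_cancel₀ (by simpa using h4), sub_self] at h5
        exact h5
  obtain ⟨s₁, hs₁, hy₁, hT₁⟩ := key H₁ hu₁
  obtain ⟨s₂, hs₂, hy₂, hT₂⟩ := key H₂ hu₂
  filter_upwards [hs₁, hy₁, hT₁, hs₂, hy₂, hT₂] with t h1 h2 h3 h4 h5 h6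
  rw [h2, h5, hTmono.injOn h1 h4 (h3.trans h6.symm)]

/-- Unique continuation for a second order equation `ÿ = G(y)` with `G` locally `C¹`. -/
theorem eq_of_eventually_eq_of_hasDerivAt {E : Type*} [NormedAddCommGroup E] [NormedSpace ℝ E]
    {G : E → E} {y₁ v₁ y₂ v₂ : ℝ → E} {δ : ℝ}
    (hG : ∀ t ∈ Set.Ioc 0 δ, ContDiffAt ℝ 1 G (y₁ t))
    (hy₁ : ∀ t ∈ Set.Ioc 0 δ, HasDerivAt y₁ (v₁ t) t)
    (hv₁ : ∀ t ∈ Set.Ioc 0 δ, HasDerivAt v₁ (G (y₁ t)) t)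
    (hy₂ : ∀ t ∈ Set.Ioc 0 δ, HasDerivAt y₂ (v₂ t) t)
    (hv₂ : ∀ t ∈ Set.Ioc 0 δ, HasDerivAt v₂ (G (y₂ t)) t)
    (heq : ∀ᶠ t in 𝓝[>] (0 : ℝ), y₁ t = y₂ t) : ∀ t ∈ Set.Ioc 0 δ, y₁ t = y₂ t := by
  intro t ht
  obtain ⟨τ, hτ, hs⟩ := mem_nhdsGT_iff_exists_Ioo_subset.1 heq
  have hτ' : (0 : ℝ) < τ := hτ
  obtain ⟨ε, hε, hετ⟩ := exists_between (lt_min ht.1 hτ')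
  have hεt : ε < t := hετ.trans_le (min_le_left _ _)
  have hmem : ∀ x ∈ Set.Icc ε t, x ∈ Set.Ioc 0 δ := fun x hx =>
    ⟨hε.trans_le hx.1, hx.2.trans ht.2⟩
  set S : Set ℝ := {x | (y₁ x, v₁ x) = (y₂ x, v₂ x)} with hS
  have hεS : ε ∈ S := by
    have hmε : ε ∈ Set.Ioo 0 τ := ⟨hε, hετ.trans_le (min_le_right _ _)⟩
    have hε' := hmem ε ⟨le_rfl, hεt.le⟩
    have h1 : y₂ =ᶠ[𝓝 ε] y₁ := by
      filter_upwards [Ioo_mem_nhds hmε.1 hmε.2] with x hx using (hs hx).symm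
    exact Prod.ext h1.eq_of_nhds.symm
      (((hy₁ ε hε').congr_of_eventuallyEq h1).unique (hy₂ ε hε'))
  have hclosed : IsClosed (S ∩ Set.Icc ε t) := by
    have h1 : ContinuousOn (fun x => (y₁ x, v₁ x)) (Set.Icc ε t) := fun x hx =>
      ((hy₁ x (hmem x hx)).continuousAt.prodMk
        (hv₁ x (hmem x hx)).continuousAt).continuousWithinAt
    have h2 : ContinuousOn (fun x => (y₂ x, v₂ x)) (Set.Icc ε t) := fun x hx =>
      ((hy₂ x (hmem x hx)).continuousAt.prodMk
        (hv₂ x (hmem x hx)).continuousAt).continuousWithinAt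
    have h3 := (h1.prodMk h2).preimage_isClosed_of_isClosed isClosed_Icc isClosed_diagonal
    rw [Set.inter_comm]
    exact h3
  have hsub : Set.Icc ε t ⊆ S := by
    refine hclosed.Icc_subset_of_forall_mem_nhdsWithin hεS fun x hx => ?_
    refine nhdsWithin_le_nhds ?_
    have hx' := hmem x ⟨hx.2.1, hx.2.2.le⟩
    have hIoc : ∀ᶠ z in 𝓝 x, z ∈ Set.Ioc 0 δ := by
      filter_upwards [Ioo_mem_nhds hx'.1 (hx.2.2.trans_le ht.2)] with z hz using ⟨hz.1, hz.2.le⟩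
    obtain ⟨K, U, hU, hK⟩ := ContDiffAt.exists_lipschitzOnWith
      (f := fun z : E × E => (z.2, G z.1)) (x := (y₁ x, v₁ x)) (𝕂 := ℝ)
      (contDiffAt_snd.prodMk (ContDiffAt.comp (g := G) (y₁ x, v₁ x) (hG x hx') contDiffAt_fst))
    have hU₂ : U ∈ 𝓝 (y₂ x, v₂ x) := by rw [← show (y₁ x, v₁ x) = (y₂ x, v₂ x) from hx.1]; exact hU
    refine ODE_solution_unique_of_eventually (v := fun _ z => (z.2, G z.1)) (s := fun _ => U)
      (f := fun x => (y₁ x, v₁ x)) (g := fun x => (y₂ x, v₂ x))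
      (Eventually.of_forall fun _ => hK) ?_ ?_ hx.1
    · filter_upwards [hIoc, ((hy₁ x hx').continuousAt.prodMk
        (hv₁ x hx').continuousAt).eventually hU] with z h1 h2
      exact ⟨(hy₁ z h1).prodMk (hv₁ z h1), h2⟩
    · filter_upwards [hIoc, ((hy₂ x hx').continuousAt.prodMk
        (hv₂ x hx').continuousAt).eventually hU₂] with z h1 h2
      exact ⟨(hy₂ z h1).prodMk (hv₂ z h1), h2⟩
  exact congrArg Prod.fst (hsub ⟨hεt.le, le_rfl⟩)

theorem contDiffAt_newton_force (m : ℝ) {d z : ℂ} (hz : z ≠ d) :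
    ContDiffAt ℝ 1 (fun z : ℂ => (m : ℂ) * (z - d) / ((‖z - d‖ ^ 3 : ℝ) : ℂ)) z := by
  have hne : z - d ≠ 0 := sub_ne_zero.2 hz
  have h1 : ContDiffAt ℝ 1 (fun z : ℂ => z - d) z := contDiffAt_id.sub contDiffAt_const
  have h2 : ContDiffAt ℝ 1 (fun z : ℂ => ((‖z - d‖ ^ 3 : ℝ) : ℂ)) z :=
    Complex.ofRealCLM.contDiff.contDiffAt.comp z ((h1.norm ℝ hne).pow 3)
  simp only [div_eq_mul_inv]
  exact (contDiffAt_const.mul h1).mul (h2.inv (by simpa using hne))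

theorem contDiffAt_newton_potential (m : ℝ) {d z : ℂ} (hz : z ≠ d) :
    ContDiffAt ℝ 1 (fun z : ℂ => m / ‖z - d‖) z := by
  have hne : z - d ≠ 0 := sub_ne_zero.2 hz
  have h1 : ContDiffAt ℝ 1 (fun z : ℂ => z - d) z := contDiffAt_id.sub contDiffAt_const
  exact contDiffAt_const.div (h1.norm ℝ hne) (norm_ne_zero_iff.2 hne)

/-- collision-reflection rigidity in the Newtonian case (α = 1). -/
theorem stmt_17 (N : ℕ) (hN : 0 < N) (c : Fin N → ℂ) (m : Fin N → ℝ)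
    (hc_inj : Function.Injective c) (hm : ∀ j, 0 < m j)
    (k : Fin N) (t₀ δ : ℝ) (hδ : 0 < δ) (y : ℝ → ℂ)
    (hy_cont : ContinuousOn y (Set.Icc (t₀ - δ) (t₀ + δ)))
    (hy0 : y t₀ = c k)
    (hy_ne : ∀ t ∈ Set.Icc (t₀ - δ) (t₀ + δ), t ≠ t₀ → ∀ j, y t ≠ c j)
    (hy_d1 : ∀ t ∈ Set.Icc (t₀ - δ) (t₀ + δ), t ≠ t₀ → DifferentiableAt ℝ y t)
    (hy_d2 : ∀ t ∈ Set.Icc (t₀ - δ) (t₀ + δ), t ≠ t₀ → DifferentiableAt ℝ (deriv y) t)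
    (hy_eq : ∀ t ∈ Set.Icc (t₀ - δ) (t₀ + δ), t ≠ t₀ →
      deriv (deriv y) t = -∑ j, (m j : ℂ) * (y t - c j) / ((‖y t - c j‖ ^ 3 : ℝ) : ℂ))
    (h : ℝ)
    (hy_energy : ∀ t ∈ Set.Icc (t₀ - δ) (t₀ + δ), t ≠ t₀ →
      (1 / 2) * ‖deriv y t‖ ^ 2 - ∑ j, m j / ‖y t - c j‖ = h)
    (u : ℂ)
    (hu_plus : Filter.Tendsto (fun t : ℝ => (y t - c k) / ((‖y t - c k‖ : ℝ) : ℂ))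
      (𝓝[>] t₀) (𝓝 u))
    (hu_minus : Filter.Tendsto (fun t : ℝ => (y t - c k) / ((‖y t - c k‖ : ℝ) : ℂ))
      (𝓝[<] t₀) (𝓝 u)) :
    ∀ t : ℝ, 0 ≤ t → t ≤ δ → y (t₀ + t) = y (t₀ - t) := by
  set G : ℂ → ℂ := fun z =>
    -∑ j, (m j : ℂ) * (z - (c j - c k)) / ((‖z - (c j - c k)‖ ^ 3 : ℝ) : ℂ) with hG
  set g : ℂ → ℂ := fun z =>
    -∑ j ∈ Finset.univ.erase k,
      (m j : ℂ) * (z - (c j - c k)) / ((‖z - (c j - c k)‖ ^ 3 : ℝ) : ℂ) with hg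
  set W : ℂ → ℝ := fun z => ∑ j ∈ Finset.univ.erase k, m j / ‖z - (c j - c k)‖ with hW
  have hcne : ∀ j ∈ Finset.univ.erase k, (0 : ℂ) ≠ c j - c k := fun j hj h0 =>
    Finset.ne_of_mem_erase hj (hc_inj (sub_eq_zero.1 h0.symm))
  have hgC : ContDiffAt ℝ 1 g 0 :=
    (ContDiffAt.sum fun j hj => contDiffAt_newton_force (m j) (hcne j hj)).neg
  have hWC : ContDiffAt ℝ 1 W 0 :=
    ContDiffAt.sum fun j hj => contDiffAt_newton_potential (m j) (hcne j hj)
  have hGg : ∀ z, G z = -((m k : ℂ) * z / ((‖z‖ ^ 3 : ℝ) : ℂ)) + g z := fun z => by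
    rw [hG, hg]
    simp only
    rw [← Finset.add_sum_erase _ _ (Finset.mem_univ k), neg_add, sub_self, sub_zero]
  have key : ∀ σ : ℝ, |σ| = 1 → ∀ t ∈ Set.Ioc 0 δ,
      HasDerivAt (fun t => y (t₀ + σ * t) - c k) (σ • deriv y (t₀ + σ * t)) t ∧
      HasDerivAt (fun t => σ • deriv y (t₀ + σ * t)) (G (y (t₀ + σ * t) - c k)) t ∧
      (∀ j, y (t₀ + σ * t) - c k ≠ c j - c k) ∧
      ‖σ • deriv y (t₀ + σ * t)‖ ^ 2
        = 2 * (m k / ‖y (t₀ + σ * t) - c k‖ + W (y (t₀ + σ * t) - c k) + h) := by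
    intro σ hσ t ht
    have habs : |σ * t| = t := by rw [abs_mul, hσ, one_mul, abs_of_pos ht.1]
    have hmem : t₀ + σ * t ∈ Set.Icc (t₀ - δ) (t₀ + δ) := by
      have := abs_le.1 (habs.le.trans ht.2)
      constructor <;> linarith
    have hne : t₀ + σ * t ≠ t₀ := fun h0 => by
      rw [add_eq_left.1 h0, abs_zero] at habs
      exact ht.1.ne habs
    have hin : HasDerivAt (fun t => t₀ + σ * t) σ t := by
      simpa using ((hasDerivAt_id t).const_mul σ).const_add t₀
    refine ⟨((hy_d1 _ hmem hne).hasDerivAt.scomp t hin).sub_const _, ?_,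
      fun j h0 => hy_ne _ hmem hne j (sub_left_injective h0), ?_⟩
    · have h1 := ((hy_d2 _ hmem hne).hasDerivAt.scomp t hin).const_smul σ
      have h2 : σ * σ = 1 := by rw [← abs_mul_abs_self, hσ, one_mul]
      rw [hy_eq _ hmem hne, smul_smul, h2, one_smul] at h1
      have h3 : G (y (t₀ + σ * t) - c k) = -∑ j, (m j : ℂ) * (y (t₀ + σ * t) - c j) /
          ((‖y (t₀ + σ * t) - c j‖ ^ 3 : ℝ) : ℂ) := by
        simp only [hG, sub_sub_sub_cancel_right]
      rw [h3]
      exact h1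
    · have h1 := hy_energy _ hmem hne
      rw [← Finset.add_sum_erase _ _ (Finset.mem_univ k)] at h1
      rw [norm_smul, Real.norm_eq_abs, hσ, one_mul, hW]
      simp only [sub_sub_sub_cancel_right]
      linarith
  have htends : ∀ σ : ℝ, Tendsto (fun t => t₀ + σ * t) (𝓝[>] 0) (𝓝 t₀) := fun σ => by
    have : Continuous fun t => t₀ + σ * t := by fun_prop
    simpa using (this.tendsto 0).mono_left (nhdsWithin_le_nhds (s := Set.Ioi 0))
  have hIoc : Set.Ioc 0 δ ∈ 𝓝[>] (0 : ℝ) := Ioc_mem_nhdsGT hδ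
  have hyk : ContinuousAt y t₀ :=
    hy_cont.continuousAt (Icc_mem_nhds (sub_lt_self _ hδ) (lt_add_of_pos_right _ hδ))
  have hej : ∀ σ : ℝ, |σ| = 1 → IsEjection (m k) h W g (fun t => y (t₀ + σ * t) - c k)
      (fun t => σ • deriv y (t₀ + σ * t)) := fun σ hσ =>
    { ne_zero := by
        filter_upwards [hIoc] with t ht
        simpa using (key σ hσ t ht).2.2.1 k
      hasDerivAt := by
        filter_upwards [hIoc] with t ht using (key σ hσ t ht).1
      hasDerivAt_velocity := by
        filter_upwards [hIoc] with t ht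
        rw [← hGg]
        exact (key σ hσ t ht).2.1
      energy := by
        filter_upwards [hIoc] with t ht using (key σ hσ t ht).2.2.2
      tendsto := by
        have := (hyk.tendsto.comp (htends σ)).sub_const (c k)
        rwa [hy0, sub_self] at this }
  have hone : |(1 : ℝ)| = 1 := abs_one
  have hneg : |(-1 : ℝ)| = 1 := by simp
  have hdir₁ : Tendsto (fun t => t₀ + 1 * t) (𝓝[>] 0) (𝓝[>] t₀) := by
    refine tendsto_nhdsWithin_iff.2 ⟨htends 1, ?_⟩
    filter_upwards [self_mem_nhdsWithin] with t ht
    simpa using ht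
  have hdir₂ : Tendsto (fun t => t₀ + -1 * t) (𝓝[>] 0) (𝓝[<] t₀) := by
    refine tendsto_nhdsWithin_iff.2 ⟨htends (-1), ?_⟩
    filter_upwards [self_mem_nhdsWithin] with t ht
    simpa using ht
  have hev := (hej 1 hone).eventually_eq (hej (-1) hneg) (hm k) hWC hgC
    (hu_plus.comp hdir₁) (hu_minus.comp hdir₂)
  have hall := eq_of_eventually_eq_of_hasDerivAt (G := G)
    (fun t ht => (ContDiffAt.sum fun j _ =>
      contDiffAt_newton_force (m j) ((key 1 hone t ht).2.2.1 j)).neg)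
    (fun t ht => (key 1 hone t ht).1) (fun t ht => (key 1 hone t ht).2.1)
    (fun t ht => (key (-1) hneg t ht).1) (fun t ht => (key (-1) hneg t ht).2.1) hev
  intro t ht0 htδ
  rcases ht0.eq_or_lt with rfl | hpos
  · simp
  · simpa [sub_eq_add_neg] using hall t ⟨hpos, htδ⟩
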